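/- arXiv:2601.07950 — 2 statements merged into one kernel-verified Lean document; each statement's English description precedes it below -/
import Mathlib

section
/- Let m and M be positive integers such that D(⟦-m,M⟧) = m + M - 1. Then ρ(m,M) = 1, and every minimal zero-sum multiset with elements in ⟦-m,M⟧ of cardinality m + M - 1 is either the multiset consisting of m-1 copies of M and M copies of -(m-1) (in which case gcd(m-1,M) = 1), or the multiset consisting of m copies of M-1 and M-1 copies of -m (in which case gcd(m,M-1) = 1). -/
def IsMinZeroSum (S : Multiset ℤ) : Prop :=
  S.sum = 0 ∧ ∀ T : Multiset ℤ, T ≤ S → T ≠ 0 → T ≠ S → T.sum ≠ 0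

noncomputable def davenport (m M : ℕ) : ℕ :=
  sSup {n : ℕ | ∃ S : Multiset ℤ, IsMinZeroSum S ∧
    (∀ x ∈ S, -(m : ℤ) ≤ x ∧ x ≤ (M : ℤ)) ∧ S.card = n}

noncomputable def rho (m M : ℕ) : ℕ :=
  sInf {t : ℕ | ∃ t' : ℕ, t' ≤ t ∧
    Int.gcd ((M : ℤ) - (t' : ℤ)) ((m : ℤ) - ((t - t' : ℕ) : ℤ)) = 1}

/-- A list of steps, started at height `s`, which goes up from non-positive heights and down from
positive ones; going down, it prefers the step `-m`, except at height `1`, where it avoids it. -/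
def GreedyWalk (m : ℤ) : ℤ → List ℤ → Prop
  | _, [] => True
  | s, a :: l =>
    ((s ≤ 0 → 0 < a) ∧ (0 < s → a < 0) ∧ (0 < s → s ≠ 1 → a ≠ -m → -m ∉ l) ∧
      (s = 1 → a = -m → ∀ b ∈ l, b < 0 → b = -m)) ∧ GreedyWalk m (s + a) l

namespace GreedyWalk

theorem step_of_append {m : ℤ} {a : ℤ} {q : List ℤ} : ∀ {s : ℤ} {p : List ℤ},
    GreedyWalk m s (p ++ a :: q) →
    (s + p.sum ≤ 0 → 0 < a) ∧ (0 < s + p.sum → a < 0) ∧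
      (0 < s + p.sum → s + p.sum ≠ 1 → a ≠ -m → -m ∉ q) ∧
      (s + p.sum = 1 → a = -m → ∀ b ∈ q, b < 0 → b = -m)
  | s, [], h => by simpa using h.1
  | s, c :: p, h => by
    have := step_of_append h.2
    simpa [add_assoc] using this

theorem exists_of_sum_eq_neg {m : ℤ} (hm : 0 < m) (n : ℕ) :
    ∀ (s : ℤ) (R : Multiset ℤ), R.card = n → (∀ x ∈ R, x ≠ 0) → s + R.sum = 0 →
    ∃ l : List ℤ, (l : Multiset ℤ) = R ∧ GreedyWalk m s l := by
  induction n with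
  | zero =>
    intro s R hc _ _
    exact ⟨[], by simpa using (Multiset.card_eq_zero.1 hc).symm, trivial⟩
  | succ n ih =>
    intro s R hc h0 hsum
    have extend : ∀ a ∈ R,
        ((s ≤ 0 → 0 < a) ∧ (0 < s → a < 0) ∧ (0 < s → s ≠ 1 → a ≠ -m → -m ∉ R.erase a) ∧
          (s = 1 → a = -m → ∀ b ∈ R.erase a, b < 0 → b = -m)) →
        ∃ l : List ℤ, (l : Multiset ℤ) = R ∧ GreedyWalk m s l := by
      intro a ha hstep
      obtain ⟨l, hl, hw⟩ := ih (s + a) (R.erase a)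
        (by rw [Multiset.card_erase_of_mem ha, hc]; rfl)
        (fun x hx => h0 x (Multiset.mem_of_mem_erase hx))
        (by
          have := Multiset.sum_erase ha
          linarith)
      refine ⟨a :: l, ?_, ?_, hw⟩
      · rw [← Multiset.cons_coe, hl, Multiset.cons_erase ha]
      · rw [← hl] at hstep
        simpa using hstep
    rcases le_or_gt s 0 with hs | hs
    · obtain ⟨a, ha, hpos⟩ : ∃ a ∈ R, 0 < a := by
        by_contra! hcon
        have hRn : R ≠ 0 := by
          rintro rfl
          simp at hc
        obtain ⟨a, ha⟩ := Multiset.exists_mem_of_ne_zero hRn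
        have h1 : (R.erase a).sum ≤ 0 :=
          by
            simpa using Multiset.sum_le_card_nsmul (R.erase a) 0
              fun x hx => hcon x (Multiset.mem_of_mem_erase hx)
        have h2 := Multiset.sum_erase ha
        have h3 := hcon a ha
        have h4 := h0 a ha
        omega
      exact extend a ha ⟨fun _ => hpos, fun h => by omega, fun h => by omega, fun h => by omega⟩
    · obtain ⟨a, ha, hneg⟩ : ∃ a ∈ R, a < 0 := by
        by_contra! hcon
        have := Multiset.sum_nonneg hcon
        omega
      by_cases h1 : s = 1
      · by_cases hex : ∃ b ∈ R, b < 0 ∧ b ≠ -m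
        · obtain ⟨b, hb, hb0, hbm⟩ := hex
          exact extend b hb
            ⟨fun h => by omega, fun _ => hb0, fun _ h => absurd h1 h, fun _ h => absurd h hbm⟩
        · push Not at hex
          exact extend a ha ⟨fun h => by omega, fun _ => hneg, fun _ h => absurd h1 h,
            fun _ _ b hb hb0 => hex b (Multiset.mem_of_mem_erase hb) hb0⟩
      · by_cases hmem : -m ∈ R
        · exact extend (-m) hmem
            ⟨fun h => by omega, fun _ => by omega, fun _ _ h => absurd rfl h, fun h => absurd h h1⟩
        · exact extend a ha ⟨fun h => by omega, fun _ => hneg,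
            fun _ _ _ h => hmem (Multiset.mem_of_mem_erase h), fun h => absurd h h1⟩

theorem sum_mem_Icc {m M : ℤ} : ∀ {l : List ℤ} {s : ℤ}, GreedyWalk m s l →
    (∀ x ∈ l, -m ≤ x ∧ x ≤ M) → -m + 1 ≤ s → s ≤ M - 1 →
    (∀ p q, p ++ q = l → q ≠ [] → s + p.sum ≠ 0) →
    ∀ p q, p ++ q = l → q ≠ [] → -m + 1 ≤ s + p.sum ∧ s + p.sum ≤ M - 1 := by
  intro l
  induction l with
  | nil =>
    intro s _ _ _ _ _ p q hpq hq
    simp_all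
  | cons a l ih =>
    intro s hw hb hs1 hs2 h0 p q hpq hq
    have hs0 : s ≠ 0 := by simpa using h0 [] (a :: l) rfl (by simp)
    obtain ⟨ha1, ha2⟩ := hb a (by simp)
    obtain ⟨⟨hup, hdown, -⟩, hw'⟩ := hw
    cases p with
    | nil => exact ⟨by simpa using hs1, by simpa using hs2⟩
    | cons c p =>
      obtain ⟨rfl, rfl⟩ : c = a ∧ p ++ q = l := by simpa using hpq
      have := ih hw' (fun x hx => hb x (by simp [hx])) (by omega) (by omega)
        (fun p' q' h hq' => by
          have := h0 (c :: p') q' (by simp [h]) hq'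
          simpa [add_assoc] using this) p q rfl hq
      simpa [add_assoc] using this

end GreedyWalk

/-- If no nonempty proper sub-multiset of `l` has image of sum zero, the partial sums of `l` have
pairwise distinct images. -/
theorem injOn_sum_take {G : Type*} [AddCommGroup G] (φ : ℤ →+ G) (l : List ℤ)
    (h : ∀ T : Multiset ℤ, T ≤ l → T ≠ 0 → T ≠ l → φ T.sum ≠ 0) :
    Set.InjOn (fun i => φ (l.take i).sum) (Finset.range l.length) := by
  have key : ∀ i j, i < j → j < l.length → φ (l.take i).sum ≠ φ (l.take j).sum := by
    intro i j hij hj heq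
    have hsub : List.Sublist ((l.take j).drop i) l :=
      (List.drop_sublist _ _).trans (List.take_sublist _ _)
    have hlen : ((l.take j).drop i).length = j - i := by
      simp
      omega
    refine h ((l.take j).drop i) hsub.subperm ?_ ?_ ?_
    · intro h0
      have := congrArg Multiset.card h0
      simp only [Multiset.coe_card, hlen, Multiset.card_zero] at this
      omega
    · intro h0
      have := congrArg Multiset.card h0
      simp only [Multiset.coe_card, hlen] at this
      omega
    · have hsum := List.sum_take_add_sum_drop (l.take j) i
      rw [List.take_take, min_eq_left hij.le] at hsum
      rw [Multiset.sum_coe, ← add_right_inj (φ (l.take i).sum), ← map_add, hsum, heq, add_zero]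
  intro i hi j hj hij
  simp only [Finset.coe_range, Set.mem_Iio] at hi hj
  rcases lt_trichotomy i j with hlt | heq | hgt
  · exact absurd hij (key i j hlt hj)
  · exact heq
  · exact absurd hij.symm (key j i hgt hi)

namespace IsMinZeroSum

theorem ne_zero_of_mem {S : Multiset ℤ} (hS : IsMinZeroSum S) (hc : 2 ≤ S.card) {x : ℤ}
    (hx : x ∈ S) : x ≠ 0 := by
  rintro rfl
  refine hS.2 {0} (Multiset.singleton_le.2 hx) (by simp) ?_ (by simp)
  rintro rfl
  simp at hc

theorem neg {S : Multiset ℤ} (hS : IsMinZeroSum S) : IsMinZeroSum (S.map Neg.neg) := by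
  have hsum : ∀ T : Multiset ℤ, (T.map Neg.neg).sum = -T.sum := fun T =>
    (map_multiset_sum (negAddMonoidHom : ℤ →+ ℤ) T).symm
  refine ⟨by simp only [hsum, hS.1, neg_zero], fun T hT hT0 hTS h => ?_⟩
  refine hS.2 (T.map Neg.neg) ?_ (by simpa using hT0) ?_ (by simp only [hsum, h, neg_zero])
  · simpa using Multiset.map_le_map hT (f := Neg.neg)
  · rintro rfl
    simp at hTS

/-- A minimal zero-sum sequence over `[-m, M]` that contains a positive element below `M` and a
negative element above `-m` has fewer than `m + M - 1` elements. -/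
theorem card_lt {S : Multiset ℤ} (hS : IsMinZeroSum S) {m M : ℤ} (hm : 2 ≤ m) (hM : 2 ≤ M)
    (hb : ∀ x ∈ S, -m ≤ x ∧ x ≤ M) {x y : ℤ} (hx : x ∈ S) (hx0 : 0 < x) (hxM : x < M)
    (hy : y ∈ S) (hy0 : y < 0) (hym : y ≠ -m) : (S.card : ℤ) < m + M - 1 := by
  by_contra! hcard
  have hne : ∀ z ∈ S, z ≠ 0 := fun z hz => hS.ne_zero_of_mem (by omega) hz
  obtain ⟨l, hl, hw⟩ := GreedyWalk.exists_of_sum_eq_neg (m := m) (by omega) _ x (S.erase x) rfl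
    (fun z hz => hne z (Multiset.mem_of_mem_erase hz)) ((Multiset.sum_erase hx).trans hS.1)
  have hSl : S = ((x :: l : List ℤ) : Multiset ℤ) := by
    rw [← Multiset.cons_coe, hl, Multiset.cons_erase hx]
  subst hSl
  have hinj := injOn_sum_take (AddMonoidHom.id ℤ) (x :: l) hS.2
  have hpart : ∀ p q, p ++ q = l → q ≠ [] → x + p.sum ≠ 0 := by
    intro p q hpq hq h0
    have hlen := congrArg List.length hpq
    have hq' := List.length_pos_iff.2 hq
    rw [List.length_append] at hlen
    have := @hinj (p.length + 1) (by simp; omega) 0 (by simp) (by simp [← hpq, h0])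
    omega
  have hrange := hw.sum_mem_Icc (M := M) (fun z hz => hb z (by simp [hz])) (by omega)
    (by omega) hpart
  have hmiss : ∀ p q, p ++ q = l → q ≠ [] → x + p.sum ≠ -m + 1 := by
    intro p q hpq hq heq
    rcases List.eq_nil_or_concat p with rfl | ⟨p, a, rfl⟩
    · simp at heq
      omega
    have hpq' : p ++ a :: q = l := by simpa using hpq
    have hstep := GreedyWalk.step_of_append (hpq' ▸ hw)
    have hr := hrange p (a :: q) hpq' (by simp)
    have ha := hb a (by simp [← hpq'])
    simp only [List.concat_eq_append, List.sum_append, List.sum_singleton] at heq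
    have h1 : x + p.sum = 1 := by
      by_contra h1
      rcases le_or_gt (x + p.sum) 0 with h | h
      · have := hstep.1 h
        omega
      · omega
    have ham : a = -m := by omega
    have hq2 := hstep.2.2.2 h1 ham
    have hyp : y ∈ p := by
      have : y ∈ x :: (p ++ a :: q) := by simpa [hpq'] using hy
      simp only [List.mem_cons, List.mem_append] at this
      rcases this with h | h | h | h
      · omega
      · exact h
      · omega
      · exact absurd (hq2 y h hy0) hym
    obtain ⟨p₁, p₂, rfl⟩ := List.append_of_mem hyp
    have hpq2 : p₁ ++ y :: (p₂ ++ a :: q) = l := by simpa using hpq'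
    have hstep' := GreedyWalk.step_of_append (hpq2 ▸ hw)
    have hpos : 0 < x + p₁.sum := by
      by_contra! h
      have := hstep'.1 h
      omega
    have hne1 : x + p₁.sum ≠ 1 := by
      intro h
      have hlen := congrArg List.length hpq2
      simp only [List.length_append, List.length_cons] at hlen
      have := @hinj (p₁.length + 1) (by simp; omega) (p₁.length + p₂.length + 2)
        (by simp; omega) (by
          have e1 : (x :: l).take (p₁.length + 1) = x :: p₁ := by simp [← hpq2]
          have e2 : (x :: l).take (p₁.length + p₂.length + 2) = x :: (p₁ ++ y :: p₂) := by
            rw [← hpq']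
            exact List.take_left' (l₁ := x :: (p₁ ++ y :: p₂)) (by simp; omega)
          simp only [e1, e2, List.sum_cons, AddMonoidHom.id_apply]
          rw [← List.sum_cons] at h1 h
          simpa using h.trans h1.symm)
      omega
    exact hstep'.2.2.1 hpos hne1 hym (by simp [ham])
  have hmaps : Set.MapsTo (fun i => ((x :: l).take i).sum)
      (Finset.range (x :: l).length) (Finset.Icc (-m + 2) (M - 1)) := by
    intro i hi
    simp only [Finset.coe_range, Set.mem_Iio, List.length_cons] at hi
    simp only [Finset.coe_Icc, Set.mem_Icc]
    cases i with
    | zero => simp; omega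
    | succ i =>
      have hq : l.drop i ≠ [] := by
        rw [Ne, List.drop_eq_nil_iff]
        omega
      have h1 := hrange _ _ (List.take_append_drop i l) hq
      have h2 := hmiss _ _ (List.take_append_drop i l) hq
      simp only [List.take_succ_cons, List.sum_cons]
      omega
  have := Finset.card_le_card_of_injOn _ hmaps hinj
  simp only [Finset.card_range, Int.card_Icc, Multiset.coe_card] at this hcard
  omega

/-- The non-positive part of a minimal zero-sum sequence whose remaining elements all equal `M` is
a minimal zero-sum sequence modulo `M`. -/
theorem not_dvd_sum {N : Multiset ℤ} {a : ℕ} {M : ℤ} (hM : 0 < M)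
    (hS : IsMinZeroSum (N + Multiset.replicate a M)) (hN : ∀ x ∈ N, x ≤ 0) {T : Multiset ℤ}
    (hT : T ≤ N) (hT0 : T ≠ 0) (hTN : T ≠ N) : ¬ M ∣ T.sum := by
  rintro ⟨k, hk⟩
  have hnonpos : ∀ U : Multiset ℤ, U ≤ N → U.sum ≤ 0 := fun U hU => by
    simpa using Multiset.sum_le_card_nsmul U 0 fun x hx => hN x (Multiset.mem_of_le hU hx)
  obtain ⟨U, rfl⟩ := Multiset.le_iff_exists_add.1 hT
  have h1 := hnonpos T hT
  have h2 := hnonpos U (Multiset.le_add_left U T)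
  have h3 := hS.1
  simp only [Multiset.sum_add, Multiset.sum_replicate, nsmul_eq_mul] at h3
  have hk0 : k ≤ 0 := by nlinarith
  have hka : -k ≤ a := by nlinarith
  obtain ⟨b, rfl⟩ : ∃ b : ℕ, k = -b := ⟨(-k).toNat, by omega⟩
  have hba : b ≤ a := by omega
  refine hS.2 (T + Multiset.replicate b M)
    (add_le_add hT ((Multiset.replicate_le_replicate M).2 hba)) (by simp [hT0]) ?_ ?_
  · intro h
    have := congrArg Multiset.card h
    have hU : 0 < U.card := Multiset.card_pos.2 fun h => hTN (by simp [h])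
    simp only [Multiset.card_add, Multiset.card_replicate] at this
    omega
  · rw [Multiset.sum_add, Multiset.sum_replicate, hk, nsmul_eq_mul]
    ring

end IsMinZeroSum

theorem Multiset.exists_le_card {α : Type*} (N : Multiset α) {k : ℕ} (hk : k ≤ N.card) :
    ∃ T ≤ N, T.card = k := by
  induction N using Quotient.inductionOn with
  | h l =>
    refine ⟨(l.take k : List α), (List.take_sublist k l).subperm, ?_⟩
    simpa using hk

theorem Multiset.dvd_sum_add_card_mul {M c : ℤ} {T : Multiset ℤ} (h : ∀ x ∈ T, M ∣ x + c) :
    M ∣ T.sum + T.card * c := by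
  induction T using Multiset.induction with
  | empty => simp
  | cons a T ih =>
    have h1 := h a (by simp)
    have h2 := ih fun x hx => h x (by simp [hx])
    have e : (a ::ₘ T).sum + (a ::ₘ T).card * c = a + c + (T.sum + T.card * c) := by
      rw [Multiset.sum_cons, Multiset.card_cons]
      push_cast
      ring
    rw [e]
    exact dvd_add h1 h2

section ModularMinimality

variable {M : ℕ} {N : Multiset ℤ}

theorem card_le_of_not_dvd_sum (hM : 0 < M)
    (hN : ∀ T ≤ N, T ≠ 0 → T ≠ N → ¬ (M : ℤ) ∣ T.sum) : N.card ≤ M := by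
  have : NeZero M := ⟨hM.ne'⟩
  induction N using Quotient.inductionOn with
  | h l =>
    have hinj := injOn_sum_take (Int.castAddHom (ZMod M)) l fun T h1 h2 h3 h4 =>
      hN T h1 h2 h3 ((ZMod.intCast_zmod_eq_zero_iff_dvd _ _).1 h4)
    simpa using Finset.card_le_card_of_injOn _ (fun i _ => Finset.mem_univ _) hinj

theorem dvd_sub_of_not_dvd_sum (hM : 2 ≤ M) (hc : N.card = M)
    (hN : ∀ T ≤ N, T ≠ 0 → T ≠ N → ¬ (M : ℤ) ∣ T.sum) {u v : ℤ} (hu : u ∈ N) (hv : v ∈ N) :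
    (M : ℤ) ∣ u - v := by
  have : NeZero M := ⟨by omega⟩
  by_cases huv : u = v
  · simp [huv]
  obtain ⟨N₁, rfl⟩ := Multiset.exists_cons_of_mem hu
  obtain ⟨N₂, rfl⟩ := Multiset.exists_cons_of_mem
    ((Multiset.mem_cons.1 hv).resolve_left (Ne.symm huv))
  induction N₂ using Quotient.inductionOn with
  | h l =>
    simp only [Multiset.quot_mk_to_coe, Multiset.cons_coe, Multiset.coe_card] at hN hc
    have hinj := injOn_sum_take (Int.castAddHom (ZMod M)) (u :: v :: l) fun T h1 h2 h3 h4 =>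
      hN T h1 h2 h3 ((ZMod.intCast_zmod_eq_zero_iff_dvd _ _).1 h4)
    have hsurj := Finset.surjOn_of_injOn_of_card_le _
      (fun i _ => Finset.mem_coe.2 (Finset.mem_univ _)) hinj
      (by simp only [Finset.card_univ, ZMod.card, Finset.card_range, hc, le_refl])
    obtain ⟨k, hk, hkv⟩ := hsurj (Finset.mem_coe.2 (Finset.mem_univ (v : ZMod M)))
    simp only [Finset.coe_range, Set.mem_Iio, hc] at hk
    have hdvd : (M : ℤ) ∣ ((u :: v :: l).take k).sum - v := by
      rw [← ZMod.intCast_zmod_eq_zero_iff_dvd]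
      simpa [sub_eq_zero] using hkv
    match k with
    | 0 =>
      refine absurd ?_ (hN {v} (by simp) (by simp) ?_)
      · simpa using hdvd
      · intro h
        have := congrArg Multiset.card h
        simp only [Multiset.card_singleton, Multiset.coe_card] at this
        omega
    | 1 => simpa using hdvd
    | k + 2 =>
      refine absurd ?_ (hN (u :: l.take k : List ℤ) ?_ (by simp) ?_)
      · convert hdvd using 1
        simp only [Multiset.sum_coe, List.take_succ_cons, List.sum_cons]
        ring
      · exact List.Sublist.subperm (((List.take_sublist k l).cons v).cons_cons u)
      · intro h
        have := congrArg Multiset.card h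
        simp only [Multiset.coe_card, List.length_cons, List.length_take] at this hc
        omega

theorem gcd_eq_one_of_not_dvd_sum {c : ℕ} (hM : 0 < M) (hc : N.card = M)
    (hN : ∀ T ≤ N, T ≠ 0 → T ≠ N → ¬ (M : ℤ) ∣ T.sum) (h : ∀ x ∈ N, (M : ℤ) ∣ x + c) :
    Nat.gcd c M = 1 := by
  by_contra hne
  obtain ⟨c', hc'⟩ := Nat.gcd_dvd_left c M
  obtain ⟨k, hk⟩ := Nat.gcd_dvd_right c M
  have hpos : 0 < Nat.gcd c M := Nat.gcd_pos_of_pos_right c hM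
  generalize Nat.gcd c M = d at *
  have hk0 : 0 < k := Nat.pos_of_ne_zero (by rintro rfl; omega)
  have hkM : k < M := by
    have : 2 ≤ d := by omega
    nlinarith
  obtain ⟨T, hT, hTc⟩ := N.exists_le_card (k := k) (by omega)
  refine hN T hT ?_ ?_ ?_
  · rintro rfl
    simp at hTc
    omega
  · rintro rfl
    omega
  · have h1 := Multiset.dvd_sum_add_card_mul fun x hx => h x (Multiset.mem_of_le hT hx)
    have h2 : (M : ℤ) ∣ T.card * c := ⟨c', by
      rw [hTc, hc', hk]
      push_cast
      ring⟩
    exact (dvd_add_left h2).1 h1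

end ModularMinimality

theorem IsMinZeroSum.eq_replicate_add_replicate {m M : ℕ} (hm : 2 ≤ m) (hM : 2 ≤ M)
    (hg : Nat.gcd m M ≠ 1) {S : Multiset ℤ} (hS : IsMinZeroSum S)
    (hb : ∀ x ∈ S, -(m : ℤ) ≤ x ∧ x ≤ M) (hc : (S.card : ℤ) = m + M - 1)
    (hpos : ∀ x ∈ S, 0 < x → x = M) :
    S = Multiset.replicate (m - 1) (M : ℤ) + Multiset.replicate M (-((m : ℤ) - 1)) ∧
      Nat.gcd (m - 1) M = 1 := by
  obtain ⟨N, a, rfl, hN0⟩ : ∃ (N : Multiset ℤ) (a : ℕ),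
      S = N + Multiset.replicate a (M : ℤ) ∧ ∀ x ∈ N, x ≤ 0 := by
    refine ⟨S.filter (· ≤ 0), (S.filter (¬ · ≤ 0)).card, ?_,
      fun x hx => (Multiset.mem_filter.1 hx).2⟩
    rw [← Multiset.eq_replicate_card.2 fun x hx => ?_, Multiset.filter_add_not]
    rw [Multiset.mem_filter] at hx
    exact hpos x hx.1 (by omega)
  have hbN : ∀ x ∈ N, -(m : ℤ) ≤ x := fun x hx => (hb x (by simp [hx])).1
  have hnd : ∀ T ≤ N, T ≠ 0 → T ≠ N → ¬ (M : ℤ) ∣ T.sum := fun T h1 h2 h3 =>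
    hS.not_dvd_sum (by omega) hN0 h1 h2 h3
  have hle := card_le_of_not_dvd_sum (by omega) hnd
  have hsum := hS.1
  simp only [Multiset.sum_add, Multiset.sum_replicate, nsmul_eq_mul] at hsum
  simp only [Multiset.card_add, Multiset.card_replicate, Nat.cast_add] at hc
  have hlow : (N.card : ℤ) * -(m : ℤ) ≤ N.sum := by
    simpa using Multiset.card_nsmul_le_sum hbN
  have hNc : N.card = M := by
    by_contra hne
    have h1 : (N.card : ℤ) ≤ M - 1 := by omega
    have h2 : (m : ℤ) ≤ a := by omega
    nlinarith
  obtain rfl : a = m - 1 := by omega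
  have hcong := fun u hu v hv => dvd_sub_of_not_dvd_sum (u := u) (v := v) hM hNc hnd hu hv
  have hnm : -(m : ℤ) ∉ N := fun hmem => hg <|
    gcd_eq_one_of_not_dvd_sum (by omega) hNc hnd fun x hx => by
      simpa using hcong x hx _ hmem
  have hge : ∀ x ∈ N, -((m : ℤ) - 1) ≤ x := fun x hx => by
    have h1 := hbN x hx
    have h2 : x ≠ -m := fun h => hnm (h ▸ hx)
    omega
  have hall : ∀ x ∈ N, x = -((m : ℤ) - 1) := by
    intro x hx
    obtain ⟨N', rfl⟩ := Multiset.exists_cons_of_mem hx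
    have h1 := Multiset.card_nsmul_le_sum fun y hy => hge y (Multiset.mem_cons_of_mem hy)
    have h2 := hge x hx
    rw [Multiset.card_cons] at hNc
    rw [Multiset.sum_cons, Nat.cast_sub (by omega)] at hsum
    rw [nsmul_eq_mul] at h1
    have h3 : (N'.card : ℤ) = M - 1 := by omega
    rw [h3] at h1
    push_cast at hsum
    nlinarith
  obtain rfl : N = Multiset.replicate M (-((m : ℤ) - 1)) := Multiset.eq_replicate.2 ⟨hNc, hall⟩
  refine ⟨add_comm _ _, gcd_eq_one_of_not_dvd_sum (by omega) hNc hnd fun x hx => ?_⟩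
  rw [hall x hx, Nat.cast_sub (by omega)]
  simp

theorem isMinZeroSum_replicate_add_replicate {m M : ℕ} (hm : 0 < m) (hM : 0 < M)
    (h : Nat.gcd m M = 1) :
    IsMinZeroSum (Multiset.replicate m (M : ℤ) + Multiset.replicate M (-(m : ℤ))) := by
  refine ⟨by simp [mul_comm], fun T hT hT0 hTS hsum => ?_⟩
  have hne : (M : ℤ) ≠ -m := by omega
  have hmem : ∀ x ∈ T, x = M ∨ x = -m := fun x hx => by
    have := Multiset.mem_of_le hT hx
    simp only [Multiset.mem_add, Multiset.mem_replicate] at this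
    exact this.imp And.right And.right
  have hTeq : T = Multiset.replicate (T.count (M : ℤ)) (M : ℤ) +
      Multiset.replicate (T.count (-(m : ℤ))) (-(m : ℤ)) := by
    ext x
    by_cases h1 : x = M
    · simp [h1, Multiset.count_replicate, hne.symm]
    by_cases h2 : x = -m
    · simp [h2, Multiset.count_replicate, hne]
    rw [Multiset.count_eq_zero_of_notMem fun hx => (hmem x hx).elim h1 h2]
    simp [Multiset.count_replicate, Ne.symm h1, Ne.symm h2]
  have ha : T.count (M : ℤ) ≤ m := by
    simpa [Multiset.count_replicate, hne.symm] using Multiset.count_le_of_le (M : ℤ) hT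
  generalize T.count (M : ℤ) = a at *
  generalize T.count (-(m : ℤ)) = b at *
  subst hTeq
  have hab : a * M = b * m := by
    simp only [Multiset.sum_add, Multiset.sum_replicate, nsmul_eq_mul] at hsum
    zify
    linarith
  have hdvd : m ∣ a := Nat.Coprime.dvd_of_dvd_mul_right h ⟨b, by rw [hab, mul_comm]⟩
  rcases Nat.eq_zero_or_pos a with rfl | ha0
  · have : b = 0 := by simpa [hm.ne'] using hab.symm
    simp [this] at hT0
  · obtain rfl := le_antisymm ha (Nat.le_of_dvd ha0 hdvd)
    have : M = b := Nat.eq_of_mul_eq_mul_left ha0 (hab.trans (mul_comm _ _))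
    exact hTS (by rw [this])

theorem IsMinZeroSum.eq_or_eq {m M : ℕ} (hm : 2 ≤ m) (hM : 2 ≤ M) (hg : Nat.gcd m M ≠ 1)
    {S : Multiset ℤ} (hS : IsMinZeroSum S) (hb : ∀ x ∈ S, -(m : ℤ) ≤ x ∧ x ≤ (M : ℤ))
    (hc : (S.card : ℤ) = (m : ℤ) + (M : ℤ) - 1) :
    (S = Multiset.replicate (m - 1) (M : ℤ) + Multiset.replicate M (-((m : ℤ) - 1)) ∧
      Nat.gcd (m - 1) M = 1) ∨
    (S = Multiset.replicate m ((M : ℤ) - 1) + Multiset.replicate (M - 1) (-(m : ℤ)) ∧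
      Nat.gcd m (M - 1) = 1) := by
  by_cases hpos : ∀ x ∈ S, 0 < x → x = M
  · exact Or.inl (hS.eq_replicate_add_replicate hm hM hg hb hc hpos)
  by_cases hneg : ∀ x ∈ S, x < 0 → x = -m
  · right
    obtain ⟨h1, h2⟩ := hS.neg.eq_replicate_add_replicate hM hm (by rwa [Nat.gcd_comm])
      (fun x hx => by
        obtain ⟨y, hy, rfl⟩ := Multiset.mem_map.1 hx
        have := hb y hy
        omega)
      (by
        rw [Multiset.card_map, hc]
        ring)
      (fun x hx hx0 => by
        obtain ⟨y, hy, rfl⟩ := Multiset.mem_map.1 hx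
        have := hneg y hy (by omega)
        omega)
    refine ⟨?_, by rwa [Nat.gcd_comm]⟩
    have h3 := congrArg (Multiset.map Neg.neg) h1
    rw [Multiset.map_map, Multiset.map_add, Multiset.map_replicate, Multiset.map_replicate,
      neg_neg, add_comm] at h3
    simpa only [Function.comp_def, neg_neg, Multiset.map_id'] using h3
  · push Not at hpos hneg
    obtain ⟨x, hx, hx0, hxM⟩ := hpos
    obtain ⟨y, hy, hy0, hym⟩ := hneg
    have hxb := hb x hx
    have := hS.card_lt (m := m) (M := M) (by omega) (by omega) hb hx hx0 (by omega) hy hy0 hym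
    omega

theorem stmt_14 (m M : ℕ) (hm : 0 < m) (hM : 0 < M)
    (hD : (davenport m M : ℤ) = (m : ℤ) + (M : ℤ) - 1) :
    rho m M = 1 ∧ ∀ S : Multiset ℤ, IsMinZeroSum S →
      (∀ x ∈ S, -(m : ℤ) ≤ x ∧ x ≤ (M : ℤ)) → (S.card : ℤ) = (m : ℤ) + (M : ℤ) - 1 →
      (S = Multiset.replicate (m - 1) (M : ℤ) + Multiset.replicate M (-((m : ℤ) - 1)) ∧
        Nat.gcd (m - 1) M = 1) ∨
      (S = Multiset.replicate m ((M : ℤ) - 1) + Multiset.replicate (M - 1) (-(m : ℤ)) ∧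
        Nat.gcd m (M - 1) = 1) := by
  have hbdd : BddAbove {n : ℕ | ∃ S : Multiset ℤ, IsMinZeroSum S ∧
      (∀ x ∈ S, -(m : ℤ) ≤ x ∧ x ≤ (M : ℤ)) ∧ S.card = n} := by
    by_contra hcon
    rw [davenport, Nat.sSup_of_not_bddAbove hcon] at hD
    omega
  have hg : Nat.gcd m M ≠ 1 := fun hg => by
    have hle : m + M ≤ davenport m M := le_csSup hbdd
      ⟨_, isMinZeroSum_replicate_add_replicate hm hM hg, fun x hx => by
        simp only [Multiset.mem_add, Multiset.mem_replicate] at hx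
        omega, by simp⟩
    omega
  have hm2 : 2 ≤ m := by
    by_contra hcon
    obtain rfl : m = 1 := by omega
    simp at hg
  have hM2 : 2 ≤ M := by
    by_contra hcon
    obtain rfl : M = 1 := by omega
    simp at hg
  refine ⟨?_, fun S hS hb hc => hS.eq_or_eq hm2 hM2 hg hb hc⟩
  have hmax : davenport m M ∈ {n : ℕ | ∃ S : Multiset ℤ, IsMinZeroSum S ∧
      (∀ x ∈ S, -(m : ℤ) ≤ x ∧ x ≤ (M : ℤ)) ∧ S.card = n} :=
    Nat.sSup_mem ⟨0, 0, ⟨by simp, by simp +contextual⟩, by simp, by simp⟩ hbdd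
  obtain ⟨S, hS, hb, hc⟩ := hmax
  have hmem : ∃ t' : ℕ, t' ≤ 1 ∧
      Int.gcd ((M : ℤ) - (t' : ℤ)) ((m : ℤ) - ((1 - t' : ℕ) : ℤ)) = 1 := by
    rcases hS.eq_or_eq hm2 hM2 hg hb ((congrArg _ hc).trans hD) with ⟨-, h⟩ | ⟨-, h⟩
    · refine ⟨0, by omega, ?_⟩
      rw [Nat.gcd_comm] at h
      have e : (m : ℤ) - ((1 - 0 : ℕ) : ℤ) = ((m - 1 : ℕ) : ℤ) := by omega
      rwa [e, Nat.cast_zero, sub_zero, Int.gcd_natCast_natCast]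
    · refine ⟨1, le_rfl, ?_⟩
      rw [Nat.gcd_comm] at h
      have e : (M : ℤ) - ((1 : ℕ) : ℤ) = ((M - 1 : ℕ) : ℤ) := by omega
      rwa [e, Nat.sub_self, Nat.cast_zero, sub_zero, Int.gcd_natCast_natCast]
  refine le_antisymm (Nat.sInf_le hmem) (Nat.one_le_iff_ne_zero.2 fun h0 => ?_)
  obtain ⟨t', ht', h⟩ : rho m M ∈ {t : ℕ | ∃ t' : ℕ, t' ≤ t ∧
      Int.gcd ((M : ℤ) - (t' : ℤ)) ((m : ℤ) - ((t - t' : ℕ) : ℤ)) = 1} := Nat.sInf_mem ⟨1, hmem⟩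
  rw [h0] at ht' h
  obtain rfl : t' = 0 := by omega
  rw [Nat.sub_self, Nat.cast_zero, sub_zero, sub_zero, Int.gcd_natCast_natCast,
    Nat.gcd_comm] at h
  exact hg h
end

section
/- Let m and M be positive integers with ρ(m,M) = 3. Then D(⟦-m,M⟧) = m + M - 3. -/
theorem IsMinZeroSum.sum_ne_of_lt {S U R U' : Multiset ℤ} (hS : IsMinZeroSum S) (hUR : U + R = S)
    (hR : R ≠ 0) (hle : U' ≤ U) (hne : U' ≠ U) : U'.sum ≠ U.sum := by
  obtain ⟨W, rfl⟩ := Multiset.le_iff_exists_add.1 hle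
  intro h
  have hW : W ≠ 0 := by
    rintro rfl
    simp at hne
  refine hS.2 W ?_ hW ?_ ?_
  · rw [← hUR, add_comm U' W, add_assoc]
    exact Multiset.le_add_right _ _
  · intro hWS
    have hc := congrArg Multiset.card (hUR.trans hWS.symm)
    have := Multiset.card_pos.2 hR
    simp only [Multiset.card_add] at hc
    omega
  · rw [Multiset.sum_add] at h
    linarith

theorem exists_pos_of_sum_nonneg {R : Multiset ℤ} (hR : R ≠ 0) (h0 : (0 : ℤ) ∉ R)
    (hs : 0 ≤ R.sum) : ∃ x ∈ R, 0 < x := by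
  induction R using Multiset.induction_on with
  | empty => exact absurd rfl hR
  | cons x R ih =>
    by_cases hx : 0 < x
    · exact ⟨x, Multiset.mem_cons_self x R, hx⟩
    · have hx0 : x ≠ 0 := fun h => h0 (h ▸ Multiset.mem_cons_self x R)
      rw [Multiset.sum_cons] at hs
      have hR' : R ≠ 0 := by
        rintro rfl
        simp at hs
        omega
      obtain ⟨y, hy, hy0⟩ := ih hR' (fun h => h0 (Multiset.mem_cons_of_mem h)) (by omega)
      exact ⟨y, Multiset.mem_cons_of_mem hy, hy0⟩

theorem exists_neg_of_sum_neg {R : Multiset ℤ} (hs : R.sum < 0) : ∃ x ∈ R, x < 0 := by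
  by_contra! h
  exact absurd (Multiset.sum_nonneg h) (by omega)

/-- Choosing an element with property `p`, which must moreover satisfy `q` whenever the current
position `s` lies in `H`, while keeping enough elements with both properties in reserve for the
positions of `H` not yet in `W`. -/
theorem exists_mem_reserve {R : Multiset ℤ} {p q : ℤ → Prop} [DecidablePred p] [DecidablePred q]
    {H W : Finset ℤ} {s : ℤ} (hs : s ∉ W) (hex : ∃ x ∈ R, p x)
    (hres : (∀ x ∈ R, p x → q x) ∨ (H \ W).card ≤ R.countP (fun x => p x ∧ q x)) :
    ∃ x R', R = x ::ₘ R' ∧ p x ∧ (s ∈ H → q x) ∧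
      ((∀ y ∈ R', p y → q y) ∨ (H \ insert s W).card ≤ R'.countP (fun x => p x ∧ q x)) := by
  by_cases hall : ∀ x ∈ R, p x → q x
  · obtain ⟨x, hx, hpx⟩ := hex
    obtain ⟨R', rfl⟩ := Multiset.exists_cons_of_mem hx
    exact ⟨x, R', rfl, hpx, fun _ => hall x hx hpx,
      Or.inl fun y hy => hall y (Multiset.mem_cons_of_mem hy)⟩
  · have hcard := hres.resolve_left hall
    have hsub : H \ insert s W ⊆ H \ W :=
      Finset.sdiff_subset_sdiff le_rfl (Finset.subset_insert s W)
    by_cases hsH : s ∈ H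
    · have hlt : (H \ insert s W).card < (H \ W).card := by
        refine Finset.card_lt_card ((Finset.ssubset_iff_of_subset hsub).2 ⟨s, ?_, ?_⟩)
        · simp [hsH, hs]
        · simp
      obtain ⟨x, hx, hpq⟩ := Multiset.countP_pos.1 (by omega : 0 < R.countP fun x => p x ∧ q x)
      obtain ⟨R', rfl⟩ := Multiset.exists_cons_of_mem hx
      rw [Multiset.countP_cons_of_pos (p := fun x => p x ∧ q x) _ hpq] at hcard
      exact ⟨x, R', rfl, hpq.1, fun _ => hpq.2, Or.inr (by omega)⟩
    · push Not at hall
      obtain ⟨x, hx, hpx, hqx⟩ := hall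
      obtain ⟨R', rfl⟩ := Multiset.exists_cons_of_mem hx
      rw [Multiset.countP_cons_of_neg (p := fun x => p x ∧ q x) _ (fun h => hqx h.2)] at hcard
      exact ⟨x, R', rfl, hpx, fun h => absurd h hsH,
        Or.inr ((Finset.card_le_card hsub).trans hcard)⟩

/-- The state of a walk through the partial sums of an ordering of `S`: `U` has been used, `R`
remains, and `W` consists of values in `[lo, hi]` of sums of proper sub-multisets of `U`. -/
structure IsWalk (S : Multiset ℤ) (lo hi : ℤ) (U R : Multiset ℤ) (W : Finset ℤ) : Prop where
  add_eq : U + R = S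
  lo_le : lo ≤ U.sum
  le_hi : U.sum ≤ hi
  subset : W ⊆ Finset.Icc lo hi
  sums : ∀ v ∈ W, ∃ U' ≤ U, U' ≠ U ∧ U'.sum = v

namespace IsWalk

variable {S : Multiset ℤ} {lo hi : ℤ} {U R : Multiset ℤ} {W : Finset ℤ}

theorem mem (hw : IsWalk S lo hi U R W) {x : ℤ} (hx : x ∈ R) : x ∈ S :=
  hw.add_eq ▸ Multiset.mem_add.2 (Or.inr hx)

theorem sum_notMem (hw : IsWalk S lo hi U R W) (hS : IsMinZeroSum S) (hR : R ≠ 0) :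
    U.sum ∉ W := by
  intro hmem
  obtain ⟨U', hle, hne, hsum⟩ := hw.sums _ hmem
  exact hS.sum_ne_of_lt hw.add_eq hR hle hne hsum

theorem exists_pos (hw : IsWalk S lo hi U R W) (hS : IsMinZeroSum S) (h0 : (0 : ℤ) ∉ S)
    (hR : R ≠ 0) (hs : U.sum ≤ 0) : ∃ x ∈ R, 0 < x := by
  have htot : U.sum + R.sum = 0 := by rw [← Multiset.sum_add, hw.add_eq, hS.1]
  exact exists_pos_of_sum_nonneg hR (fun hm => h0 (hw.mem hm)) (by omega)

theorem exists_neg (hw : IsWalk S lo hi U R W) (hS : IsMinZeroSum S)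
    (hs : 0 < U.sum) : ∃ x ∈ R, x < 0 := by
  have htot : U.sum + R.sum = 0 := by rw [← Multiset.sum_add, hw.add_eq, hS.1]
  exact exists_neg_of_sum_neg (by omega)

theorem step {x : ℤ} (hw : IsWalk S lo hi U (x ::ₘ R) W) (hlo : lo ≤ x + U.sum)
    (hhi : x + U.sum ≤ hi) : IsWalk S lo hi (x ::ₘ U) R (insert U.sum W) where
  add_eq := by rw [← hw.add_eq]; simp
  lo_le := by simpa using hlo
  le_hi := by simpa using hhi
  subset := Finset.insert_subset (Finset.mem_Icc.2 ⟨hw.lo_le, hw.le_hi⟩) hw.subset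
  sums := by
    intro v hv
    rcases Finset.mem_insert.1 hv with rfl | hv
    · exact ⟨U, Multiset.le_cons_self U x,
        fun h => by simpa using congrArg Multiset.card h, rfl⟩
    · obtain ⟨U', hle, -, hsum⟩ := hw.sums v hv
      refine ⟨U', hle.trans (Multiset.le_cons_self U x), ?_, hsum⟩
      rintro rfl
      exact absurd (Multiset.card_le_card hle) (by simp)

/-- A walk at any position can be continued by negative steps to a position that is at most `0`. -/
theorem exists_descent {b : ℤ} (hS : IsMinZeroSum S) (hbd : ∀ x ∈ S, -b ≤ x) (n : ℕ) :
    ∀ (U R : Multiset ℤ) (W : Finset ℤ), R.card = n → IsWalk S (1 - b) hi U R W →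
      ∃ U' R' W', IsWalk S (1 - b) hi U' R' W' ∧ U ≤ U' ∧ U'.sum ≤ 0 ∧ U'.sum ≤ U.sum ∧
        W'.card + R'.card = W.card + R.card ∧ (∀ v ∈ W', v ∈ W ∨ v ≤ U.sum) ∧
        R'.filter (0 < ·) = R.filter (0 < ·) := by
  induction n with
  | zero =>
    intro U R W hn hw
    rw [Multiset.card_eq_zero] at hn
    subst hn
    have := hw.add_eq
    rw [add_zero] at this
    exact ⟨U, 0, W, hw, le_rfl, by rw [this, hS.1], le_rfl, rfl, fun v hv => Or.inl hv, rfl⟩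
  | succ n ih =>
    intro U R W hn hw
    rcases le_or_gt U.sum 0 with hs | hs
    · exact ⟨U, R, W, hw, le_rfl, hs, le_rfl, rfl, fun v hv => Or.inl hv, rfl⟩
    · obtain ⟨x, hxR, hx⟩ := hw.exists_neg hS hs
      have hxS := hbd x (hw.mem hxR)
      have hfresh := hw.sum_notMem hS (by rintro rfl; simp at hn)
      have hhi := hw.le_hi
      obtain ⟨R, rfl⟩ := Multiset.exists_cons_of_mem hxR
      obtain ⟨U', R', W', h1, h2, h3, h4, h5, h6, h7⟩ := ih (x ::ₘ U) R (insert U.sum W)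
        (by simpa using hn) (hw.step (by omega) (by omega))
      rw [Multiset.sum_cons] at h4 h6
      rw [Finset.card_insert_of_notMem hfresh] at h5
      refine ⟨U', R', W', h1, (Multiset.le_cons_self U x).trans h2, h3, by omega, ?_, ?_, ?_⟩
      · rw [Multiset.card_cons]
        omega
      · intro v hv
        rcases h6 v hv with hv | hv
        · rcases Finset.mem_insert.1 hv with rfl | hv
          · exact Or.inr le_rfl
          · exact Or.inl hv
        · exact Or.inr (by omega)
      · rw [h7, Multiset.filter_cons_of_neg _ (by omega)]

/-- From a position `U.sum ≤ 0`, use two positive elements `x < y` with only negative steps in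
between. Besides the positions visited, the value `y + U.sum` can be recorded. -/
theorem exists_ascent {a b x y : ℤ} (hS : IsMinZeroSum S) (hbd : ∀ z ∈ S, -b ≤ z ∧ z ≤ a)
    (hx : 0 < x) (hxy : x < y) (hw : IsWalk S (1 - b) a U (x ::ₘ y ::ₘ R) W) (hs : U.sum ≤ 0) :
    ∃ U' R' W', IsWalk S (1 - b) a U' R' W' ∧ W'.card + R'.card = W.card + R.card + 3 ∧
      R'.card < R.card + 2 ∧ R'.filter (0 < ·) = R.filter (0 < ·) := by
  have hyS := (hbd y (hw.mem (by simp))).2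
  have hlo := hw.lo_le
  have hfresh := hw.sum_notMem hS (by simp)
  have hw1 := hw.step (by omega) (by omega)
  obtain ⟨U', R', W', h1, h2, h3, h4, h5, h6, h7⟩ :=
    exists_descent hS (fun z hz => (hbd z hz).1) _ _ _ _ rfl hw1
  have hyR : y ∈ R' := by
    have : y ∈ R'.filter (0 < ·) := by
      rw [h7]
      simp
      omega
    exact Multiset.mem_of_mem_filter this
  obtain ⟨R', rfl⟩ := Multiset.exists_cons_of_mem hyR
  have hfresh' := h1.sum_notMem hS (by simp)
  have hlo' := h1.lo_le
  have hw2 := h1.step (by omega) (by omega)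
  rw [Multiset.sum_cons] at h4 h6
  have hyU : y ::ₘ U ≤ y ::ₘ U' := (Multiset.cons_le_cons_iff y).2
    ((Multiset.le_cons_self U x).trans h2)
  have hyne : y ::ₘ U ≠ y ::ₘ U' := by
    intro h
    have := Multiset.card_le_card h2
    have := congrArg Multiset.card h
    simp only [Multiset.card_cons] at *
    omega
  have hvirt : y + U.sum ∉ insert U'.sum W' := by
    rw [Finset.mem_insert, not_or]
    refine ⟨by omega, fun hv => ?_⟩
    rcases h6 _ hv with hv | hv
    · rcases Finset.mem_insert.1 hv with hv | hv
      · omega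
      · obtain ⟨V, hle, -, hsum⟩ := hw.sums _ hv
        refine hS.sum_ne_of_lt (U := y ::ₘ U) (R := x ::ₘ R) (U' := V) ?_ (by simp)
          (hle.trans (Multiset.le_cons_self U y)) ?_ (by rw [hsum, Multiset.sum_cons])
        · rw [← hw.add_eq, Multiset.cons_add, Multiset.add_cons, Multiset.add_cons,
            Multiset.add_cons, Multiset.cons_swap]
        · rintro rfl
          exact absurd (Multiset.card_le_card hle) (by simp)
    · omega
  refine ⟨y ::ₘ U', R', insert (y + U.sum) (insert U'.sum W'), ⟨hw2.add_eq, hw2.lo_le, hw2.le_hi,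
    Finset.insert_subset (Finset.mem_Icc.2 ⟨by omega, by omega⟩) hw2.subset, ?_⟩, ?_, ?_, ?_⟩
  · intro v hv
    rcases Finset.mem_insert.1 hv with rfl | hv
    · exact ⟨y ::ₘ U, hyU, hyne, Multiset.sum_cons y U⟩
    · exact hw2.sums v hv
  · rw [Finset.card_insert_of_notMem hvirt, Finset.card_insert_of_notMem hfresh']
    rw [Finset.card_insert_of_notMem hfresh, Multiset.card_cons, Multiset.card_cons] at h5
    omega
  · have := congrArg Multiset.card h1.add_eq
    have h' := congrArg Multiset.card hw.add_eq
    have := Multiset.card_le_card h2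
    simp only [Multiset.card_add, Multiset.card_cons] at *
    omega
  · have hy : 0 < y := by omega
    rw [Multiset.filter_cons_of_pos _ hy, Multiset.filter_cons_of_pos _ hy] at h7
    exact (Multiset.cons_inj_right y).1 h7

theorem card_add_le {a b y : ℤ} (hS : IsMinZeroSum S) (h0 : (0 : ℤ) ∉ S)
    (hbd : ∀ z ∈ S, -b ≤ z ∧ z ≤ a) (hab : 0 ≤ a + b) (hy : 0 < y) (n : ℕ) :
    ∀ (U R : Multiset ℤ) (W : Finset ℤ) (k : ℕ), R.card = n → IsWalk S (1 - b) a U R W →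
      k ≤ R.count y → k ≤ R.countP (fun x => 0 < x ∧ x < y) →
      (W.card + R.card + k : ℤ) ≤ a + b := by
  induction n using Nat.strong_induction_on with
  | _ n ih =>
    intro U R W k hn hw hk hk'
    have hbound : (W.card : ℤ) ≤ a + b := by
      have := Finset.card_le_card hw.subset
      rw [Int.card_Icc] at this
      omega
    by_cases hR : R = 0
    · subst hR
      simp at hk ⊢
      omega
    have hfresh := hw.sum_notMem hS hR
    have hlo := hw.lo_le
    have hhi := hw.le_hi
    rcases lt_or_ge 0 U.sum with hs | hs
    · obtain ⟨x, hxR, hx⟩ := hw.exists_neg hS hs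
      have hxS := hbd x (hw.mem hxR)
      obtain ⟨R, rfl⟩ := Multiset.exists_cons_of_mem hxR
      rw [Multiset.count_cons_of_ne (by omega)] at hk
      rw [Multiset.countP_cons_of_neg _ (by omega)] at hk'
      have := ih R.card (by simp [← hn]) _ _ _ k rfl (hw.step (by omega) (by omega)) hk hk'
      rw [Finset.card_insert_of_notMem hfresh] at this
      rw [Multiset.card_cons]
      push_cast at this ⊢
      omega
    · rcases Nat.eq_zero_or_pos k with rfl | hkpos
      · obtain ⟨x, hxR, hx⟩ := hw.exists_pos hS h0 hR hs
        have hxS := hbd x (hw.mem hxR)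
        obtain ⟨R, rfl⟩ := Multiset.exists_cons_of_mem hxR
        have := ih R.card (by simp [← hn]) _ _ _ 0 rfl (hw.step (by omega) (by omega))
          (Nat.zero_le _) (Nat.zero_le _)
        rw [Finset.card_insert_of_notMem hfresh] at this
        rw [Multiset.card_cons]
        push_cast at this ⊢
        omega
      · obtain ⟨x, hxR, hx, hxy⟩ := Multiset.countP_pos.1 (hkpos.trans_le hk')
        obtain ⟨R, rfl⟩ := Multiset.exists_cons_of_mem hxR
        rw [Multiset.count_cons_of_ne (by omega)] at hk
        obtain ⟨R, rfl⟩ := Multiset.exists_cons_of_mem (Multiset.count_pos.1 (hkpos.trans_le hk))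
        obtain ⟨U', R', W', h1, h2, h3, h4⟩ := hw.exists_ascent hS hbd hx hxy hs
        rw [Multiset.count_cons_self] at hk
        rw [Multiset.countP_cons_of_pos (p := fun x => 0 < x ∧ x < y) _ ⟨hx, hxy⟩,
          Multiset.countP_cons_of_neg _ (by omega)] at hk'
        have hfil (p : ℤ → Prop) [DecidablePred p] (hp : ∀ z, p z → 0 < z) :
            R'.countP p = R.countP p := by
          have hcongr (T : Multiset ℤ) : T.countP p = (T.filter (0 < ·)).countP p := by
            rw [Multiset.countP_filter]
            exact Multiset.countP_congr rfl fun z _ => by simpa using hp z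
          rw [hcongr R', h4, ← hcongr R]
        have hc := hfil (y = ·) (fun z hz => hz ▸ hy)
        have hc' := hfil (fun x => 0 < x ∧ x < y) (fun z hz => hz.1)
        simp only [Multiset.card_cons] at hn ⊢
        have := ih R'.card (by omega) U' R' W' (k - 1) rfl h1
          (by rw [Multiset.count, hc]; exact Nat.sub_le_of_le_add hk) (by omega)
        omega

end IsWalk

/-- Ascents from smaller positive elements to `y` improve the bound of Lambert's theorem. -/
theorem IsMinZeroSum.card_add_min_le {S : Multiset ℤ} (hS : IsMinZeroSum S) (h0 : (0 : ℤ) ∉ S)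
    {a b y : ℤ} (hbd : ∀ z ∈ S, -b ≤ z ∧ z ≤ a) (ha : 0 ≤ a) (hb : 0 < b) (hy : 0 < y) :
    (S.card + min (S.count y) (S.countP fun x => 0 < x ∧ x < y) : ℤ) ≤ a + b := by
  have := IsWalk.card_add_le hS h0 hbd (by omega) hy _ 0 S ∅
    (min (S.count y) (S.countP fun x => 0 < x ∧ x < y)) rfl
    ⟨by simp, by simp; omega, by simpa, by simp, by simp⟩ (min_le_left _ _) (min_le_right _ _)
  push_cast at this
  simpa using this

theorem exists_departure_set_aux {S : Multiset ℤ} (hS : IsMinZeroSum S) (h0 : (0 : ℤ) ∉ S)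
    {a b h k : ℤ} (hbd : ∀ x ∈ S, -b ≤ x ∧ x ≤ a) (n : ℕ) :
    ∀ (U R : Multiset ℤ) (W : Finset ℤ), R.card = n → IsWalk S (k + 1 - b) (a - h) U R W →
      ((∀ x ∈ R, 0 < x → x ≤ a - h) ∨
        (Finset.Icc (1 - h) 0 \ W).card ≤ R.countP (fun x => 0 < x ∧ x ≤ a - h)) →
      ((∀ x ∈ R, x < 0 → k - b ≤ x) ∨
        (Finset.Icc 1 k \ W).card ≤ R.countP (fun x => x < 0 ∧ k - b ≤ x)) →
      ∃ W' ⊆ Finset.Icc (k + 1 - b) (a - h),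
        (W'.filter (· ≤ 0)).card = (W.filter (· ≤ 0)).card + R.countP (0 < ·) ∧
        (W'.filter (0 < ·)).card = (W.filter (0 < ·)).card + R.countP (· < 0) := by
  induction n with
  | zero =>
    intro U R W hn hw hp hq
    rw [Multiset.card_eq_zero] at hn
    subst hn
    exact ⟨W, hw.subset, by simp, by simp⟩
  | succ n ih =>
    intro U R W hn hw hp hq
    have hR : R ≠ 0 := by
      rintro rfl
      simp at hn
    have hfresh := hw.sum_notMem hS hR
    have hlo := hw.lo_le
    have hhi := hw.le_hi
    have hsub : ∀ H : Finset ℤ, (H \ insert U.sum W).card ≤ (H \ W).card := fun H =>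
      Finset.card_le_card (Finset.sdiff_subset_sdiff le_rfl (Finset.subset_insert _ W))
    rcases le_or_gt U.sum 0 with hs0 | hs0
    · obtain ⟨x, R', rfl, hx, hxH, hp'⟩ := exists_mem_reserve (p := (0 < ·)) (q := (· ≤ a - h))
        hfresh (hw.exists_pos hS h0 hR hs0) hp
      have hxS := hbd x (hw.mem (Multiset.mem_cons_self x R'))
      rw [Finset.mem_Icc] at hxH
      obtain ⟨W', h1, h2, h3⟩ := ih (x ::ₘ U) R' (insert U.sum W) (by simpa using hn)
        (hw.step (by omega) (by omega)) hp' (by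
          refine hq.imp (fun hq y hy => hq y (Multiset.mem_cons_of_mem hy)) fun hq => ?_
          rw [Multiset.countP_cons_of_neg _ (by omega)] at hq
          exact (hsub _).trans hq)
      refine ⟨W', h1, ?_, ?_⟩
      · rw [h2, Finset.filter_insert, if_pos hs0, Finset.card_insert_of_notMem (by simp [hfresh]),
          Multiset.countP_cons_of_pos (p := (0 < ·)) _ hx]
        omega
      · rw [h3, Finset.filter_insert, if_neg (by omega),
          Multiset.countP_cons_of_neg (p := (· < 0)) _ (by omega)]
    · obtain ⟨x, R', rfl, hx, hxH, hq'⟩ := exists_mem_reserve (p := (· < 0)) (q := (k - b ≤ ·))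
        hfresh (hw.exists_neg hS hs0) hq
      have hxS := hbd x (hw.mem (Multiset.mem_cons_self x R'))
      rw [Finset.mem_Icc] at hxH
      obtain ⟨W', h1, h2, h3⟩ := ih (x ::ₘ U) R' (insert U.sum W) (by simpa using hn)
        (hw.step (by omega) (by omega)) (by
          refine hp.imp (fun hp y hy => hp y (Multiset.mem_cons_of_mem hy)) fun hp => ?_
          rw [Multiset.countP_cons_of_neg _ (by omega)] at hp
          exact (hsub _).trans hp) hq'
      refine ⟨W', h1, ?_, ?_⟩
      · rw [h2, Finset.filter_insert, if_neg (by omega),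
          Multiset.countP_cons_of_neg (p := (0 < ·)) _ (by omega)]
      · rw [h3, Finset.filter_insert, if_pos hs0, Finset.card_insert_of_notMem (by simp [hfresh]),
          Multiset.countP_cons_of_pos (p := (· < 0)) _ hx]
        omega

/-- If at least `h` positive elements are at most `a - h` and at least `k` negative elements are
at least `k - b`, then the bounds of Lambert's theorem improve by `h` and `k`. -/
theorem IsMinZeroSum.countP_le_of_reserve {S : Multiset ℤ} (hS : IsMinZeroSum S)
    (h0 : (0 : ℤ) ∉ S) {a b : ℤ} {h k : ℕ} (hbd : ∀ x ∈ S, -b ≤ x ∧ x ≤ a) (ha : h ≤ a)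
    (hb : k < b) (hp : h ≤ S.countP (fun x => 0 < x ∧ x ≤ a - h))
    (hq : k ≤ S.countP (fun x => x < 0 ∧ k - b ≤ x)) :
    (S.countP (0 < ·) : ℤ) ≤ b - k ∧ (S.countP (· < 0) : ℤ) ≤ a - h := by
  obtain ⟨W, hW, h1, h2⟩ := exists_departure_set_aux (h := h) (k := k) hS h0 hbd _ 0 S ∅ rfl
    ⟨by simp, by simp; omega, by simp; omega, by simp, by simp⟩ (Or.inr (by simpa using hp))
    (Or.inr (by simpa using hq))
  simp only [Finset.filter_empty, Finset.card_empty, zero_add] at h1 h2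
  rw [← h1, ← h2]
  constructor
  · have : W.filter (· ≤ 0) ⊆ Finset.Icc (k + 1 - b) 0 := by
      intro v hv
      rw [Finset.mem_filter] at hv
      exact Finset.mem_Icc.2 ⟨(Finset.mem_Icc.1 (hW hv.1)).1, hv.2⟩
    have := Finset.card_le_card this
    rw [Int.card_Icc] at this
    omega
  · have : W.filter (0 < ·) ⊆ Finset.Icc 1 (a - h) := by
      intro v hv
      rw [Finset.mem_filter] at hv
      exact Finset.mem_Icc.2 ⟨by omega, (Finset.mem_Icc.1 (hW hv.1)).2⟩
    have := Finset.card_le_card this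
    rw [Int.card_Icc] at this
    omega

theorem IsMinZeroSum.map_neg {S : Multiset ℤ} (hS : IsMinZeroSum S) :
    IsMinZeroSum (S.map Neg.neg) := by
  have hinv (T : Multiset ℤ) : (T.map Neg.neg).map Neg.neg = T := by simp
  have hsum (T : Multiset ℤ) : (T.map Neg.neg).sum = -T.sum := Multiset.sum_map_neg' T
  refine ⟨by rw [hsum, hS.1, neg_zero], fun T hT h0 hne h => ?_⟩
  refine hS.2 (T.map Neg.neg) (hinv S ▸ Multiset.map_le_map hT) (by simpa using h0) ?_
    (by rw [hsum, h, neg_zero])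
  rintro rfl
  exact hne (hinv T).symm

theorem IsMinZeroSum.eq_singleton_of_zero_mem {S : Multiset ℤ} (hS : IsMinZeroSum S)
    (h0 : (0 : ℤ) ∈ S) : S = {0} := by
  by_contra h
  exact hS.2 {0} (Multiset.singleton_le.2 h0) (by simp) (Ne.symm h) (by simp)

theorem count_neg_map_neg (S : Multiset ℤ) (y : ℤ) :
    (S.map Neg.neg).count y = S.count (-y) := by
  conv_lhs => rw [← neg_neg y]
  exact Multiset.count_map_eq_count' _ _ neg_injective _

theorem countP_map_neg (S : Multiset ℤ) (p : ℤ → Prop) [DecidablePred p] :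
    (S.map Neg.neg).countP p = S.countP fun x => p (-x) := by
  rw [Multiset.countP_map, Multiset.countP_eq_card_filter]

theorem countP_pos_le_eq_add (S : Multiset ℤ) {c : ℤ} (hc : 0 < c) :
    S.countP (fun x => 0 < x ∧ x ≤ c) =
      S.count c + S.countP (fun x => 0 < x ∧ x ≤ c - 1) := by
  induction S using Multiset.induction_on with
  | empty => simp
  | cons x S ih =>
    simp only [Multiset.countP_cons, Multiset.count_cons, ih]
    split_ifs <;> omega

/-- With enough copies of `x` and `-y`, a minimal zero-sum multiset consists only of those. -/
theorem IsMinZeroSum.card_eq_of_count {S : Multiset ℤ} (hS : IsMinZeroSum S) {x y : ℕ}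
    (hx : 0 < x) (hy : 0 < y) (hcx : y / x.gcd y ≤ S.count (x : ℤ))
    (hcy : x / x.gcd y ≤ S.count (-y : ℤ)) : S.card = y / x.gcd y + x / x.gcd y := by
  set T : Multiset ℤ :=
    Multiset.replicate (y / x.gcd y) (x : ℤ) + Multiset.replicate (x / x.gcd y) (-y : ℤ) with hT
  have hTS : T ≤ S := by
    rw [Multiset.le_iff_count]
    intro z
    rw [hT, Multiset.count_add, Multiset.count_replicate, Multiset.count_replicate]
    split_ifs with h1 h2 h2
    · exact absurd (h1.trans h2.symm) (by omega)
    · rwa [← h1, add_zero]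
    · rwa [← h2, zero_add]
    · exact Nat.zero_le _
  have hpos : 0 < x / x.gcd y :=
    Nat.div_pos (Nat.gcd_le_left y hx) (Nat.gcd_pos_of_pos_left y hx)
  have hcard : T.card = y / x.gcd y + x / x.gcd y := by simp [hT]
  have hT0 : T ≠ 0 := by
    intro h
    rw [h, Multiset.card_zero] at hcard
    exact hpos.ne' (Nat.add_eq_zero_iff.1 hcard.symm).2
  have hsum : T.sum = 0 := by
    have : y / x.gcd y * x = x / x.gcd y * y := by
      rw [Nat.div_mul_right_comm (Nat.gcd_dvd_right x y), Nat.div_mul_right_comm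
        (Nat.gcd_dvd_left x y), mul_comm]
    zify at this
    simp [hT, this]
  rw [← hcard]
  by_contra h
  exact hS.2 T hTS hT0 (fun h' => h (by rw [h'])) hsum

theorem isMinZeroSum_replicate {x y : ℕ} (hx : 0 < x) (hy : 0 < y) (h : x.Coprime y) :
    IsMinZeroSum (Multiset.replicate y (x : ℤ) + Multiset.replicate x (-y : ℤ)) := by
  refine ⟨by simp [mul_comm], fun T hT hT0 hne hsum => ?_⟩
  have hmem : ∀ z ∈ T, z = (x : ℤ) ∨ z = (-y : ℤ) := by
    intro z hz
    rcases Multiset.mem_add.1 (Multiset.mem_of_le hT hz) with hz | hz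
    · exact Or.inl (Multiset.eq_of_mem_replicate hz)
    · exact Or.inr (Multiset.eq_of_mem_replicate hz)
  have hxy : (x : ℤ) ≠ -y := by omega
  have hTeq : T = Multiset.replicate (T.count (x : ℤ)) (x : ℤ) +
      Multiset.replicate (T.count (-y : ℤ)) (-y : ℤ) := by
    ext z
    rw [Multiset.count_add, Multiset.count_replicate, Multiset.count_replicate]
    split_ifs with h1 h2 h2
    · omega
    · rw [← h1, add_zero]
    · rw [← h2, zero_add]
    · rw [Multiset.count_eq_zero]
      intro hz
      rcases hmem z hz with rfl | rfl
      · exact h1 rfl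
      · exact h2 rfl
  have hcx := Multiset.count_le_of_le (x : ℤ) hT
  have hcy := Multiset.count_le_of_le (-y : ℤ) hT
  rw [Multiset.count_add, Multiset.count_replicate, Multiset.count_replicate] at hcx hcy
  simp only [hxy, hxy.symm, if_true, if_false, add_zero, zero_add] at hcx hcy
  set i := T.count (x : ℤ)
  set j := T.count (-y : ℤ)
  have hij : i * x = j * y := by
    rw [hTeq] at hsum
    simp at hsum
    zify
    linarith
  have hyi : y ∣ i := h.symm.dvd_of_dvd_mul_right ⟨j, by rw [hij, mul_comm]⟩
  rcases Nat.eq_zero_or_pos i with hi | hi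
  · have hj : j = 0 := by
      rw [hi, zero_mul] at hij
      exact (Nat.mul_eq_zero.1 hij.symm).resolve_right hy.ne'
    rw [hi, hj] at hTeq
    exact hT0 (by simpa using hTeq)
  · have hi : i = y := le_antisymm hcx (Nat.le_of_dvd hi hyi)
    have hj : j = x := by
      rw [hi, mul_comm] at hij
      exact (Nat.eq_of_mul_eq_mul_right hy hij).symm
    rw [hi, hj] at hTeq
    exact hne hTeq

/-- In a long minimal zero-sum multiset with few small positive elements, one of the three largest
possible values dominates the positive elements. -/
theorem IsMinZeroSum.count_dominant {S : Multiset ℤ} (hS : IsMinZeroSum S) (h0 : (0 : ℤ) ∉ S)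
    {a b : ℤ} (hbd : ∀ x ∈ S, -b ≤ x ∧ x ≤ a) (ha : 4 ≤ a) (hb : 4 ≤ b)
    (hcard : a + b - 2 ≤ S.card) (hp : b - 2 ≤ S.countP (fun x => 0 < x ∧ x ≤ a))
    (hlow : S.countP (fun x => 0 < x ∧ x ≤ a - 3) ≤ 2) :
    (b - 8 ≤ S.count a ∨ b - 8 ≤ S.count (a - 1) ∨ b - 8 ≤ S.count (a - 2)) ∧
      (S.countP (fun x => 0 < x ∧ x ≤ a - 2) ≤ 1 →
        b - 8 ≤ S.count a ∨ b - 8 ≤ S.count (a - 1)) ∧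
      (S.countP (fun x => 0 < x ∧ x ≤ a - 1) = 0 → b - 8 ≤ S.count a) := by
  have asc {y : ℤ} (hy : 0 < y) :
      S.count y ≤ 2 ∨ S.countP (fun x => 0 < x ∧ x ≤ y - 1) ≤ 2 := by
    have := hS.card_add_min_le h0 hbd (by omega) (by omega) hy
    rw [Multiset.countP_congr (p' := fun x => 0 < x ∧ x ≤ y - 1) rfl
      (fun x _ => by rw [Int.le_sub_one_iff])] at this
    omega
  have a0 := asc (y := a) (by omega)
  have a1 := asc (y := a - 1) (by omega)
  have e0 := countP_pos_le_eq_add S (c := a) (by omega)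
  have e1 := countP_pos_le_eq_add S (c := a - 1) (by omega)
  have e2 := countP_pos_le_eq_add S (c := a - 2) (by omega)
  rw [show a - 1 - 1 = a - 2 by ring] at a1 e1
  rw [show a - 2 - 1 = a - 3 by ring] at e2
  refine ⟨?_, fun h => ?_, fun h => ?_⟩ <;> omega

/-- A minimal zero-sum multiset of almost maximal length is dominated by one positive and one
negative value, both close to the ends of the interval. -/
theorem IsMinZeroSum.exists_dominant {S : Multiset ℤ} (hS : IsMinZeroSum S) (h0 : (0 : ℤ) ∉ S)
    {a b : ℤ} (hbd : ∀ x ∈ S, -b ≤ x ∧ x ≤ a) (ha : 4 ≤ a) (hb : 4 ≤ b)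
    (hcard : a + b - 2 ≤ S.card) :
    ∃ i j : ℕ, i + j ≤ 2 ∧ b - 8 ≤ S.count (a - i) ∧ a - 8 ≤ S.count (-(b - j)) := by
  have h0' : (0 : ℤ) ∉ S.map Neg.neg := by simpa using h0
  have hbd' : ∀ x ∈ S.map Neg.neg, -a ≤ x ∧ x ≤ b := by
    intro x hx
    obtain ⟨y, hy, rfl⟩ := Multiset.mem_map.1 hx
    have := hbd y hy
    omega
  have hmap (c : ℤ) (k : ℕ) (hc : b - k = c) :
      S.countP (fun x => x < 0 ∧ k - b ≤ x) =
        (S.map Neg.neg).countP (fun x => 0 < x ∧ x ≤ c) := by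
    rw [countP_map_neg]
    refine Multiset.countP_congr rfl fun x _ => ?_
    simp only [eq_iff_iff]
    omega
  have htot : S.card = S.countP (0 < ·) + S.countP (· < 0) := by
    rw [Multiset.card_eq_countP_add_countP (0 < ·) S]
    congr 1
    refine Multiset.countP_congr rfl fun x hx => ?_
    have : x ≠ 0 := fun h => h0 (h ▸ hx)
    simp only [eq_iff_iff]
    omega
  have hpa : S.countP (0 < ·) = S.countP (fun x => 0 < x ∧ x ≤ a) := by
    refine Multiset.countP_congr rfl fun x hx => ?_
    have := hbd x hx
    simp only [eq_iff_iff]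
    omega
  have hqa : S.countP (· < 0) = (S.map Neg.neg).countP (fun x => 0 < x ∧ x ≤ b) := by
    rw [← hmap b 0 (by simp)]
    refine Multiset.countP_congr rfl fun x hx => ?_
    have := hbd x hx
    simp only [eq_iff_iff]
    push_cast
    omega
  have key (h k : ℕ) (hh : h ≤ 3) (hk : k ≤ 3) := hS.countP_le_of_reserve h0 (h := h) (k := k) hbd
    (by omega) (by omega)
  have k00 := key 0 0 (by omega) (by omega) (Nat.zero_le _) (Nat.zero_le _)
  push_cast at k00
  have hp : b - 2 ≤ S.countP (0 < ·) := by omega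
  have hq : a - 2 ≤ S.countP (· < 0) := by omega
  have k30 : S.countP (fun x => 0 < x ∧ x ≤ a - 3) ≤ 2 := by
    by_contra! hc
    have := (key 3 0 (by omega) (by omega) hc (Nat.zero_le _)).2
    push_cast at this
    omega
  have k03 : (S.map Neg.neg).countP (fun x => 0 < x ∧ x ≤ b - 3) ≤ 2 := by
    by_contra! hc
    have := (key 0 3 (by omega) (by omega) (Nat.zero_le _) (by rwa [hmap (b - 3) 3 rfl])).1
    push_cast at this
    omega
  have k12 : S.countP (fun x => 0 < x ∧ x ≤ a - 1) = 0 ∨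
      (S.map Neg.neg).countP (fun x => 0 < x ∧ x ≤ b - 2) ≤ 1 := by
    by_contra! hc
    have := key 1 2 (by omega) (by omega) (Nat.pos_of_ne_zero hc.1)
      (by rw [hmap (b - 2) 2 rfl]; exact hc.2)
    push_cast at this
    omega
  have k21 : S.countP (fun x => 0 < x ∧ x ≤ a - 2) ≤ 1 ∨
      (S.map Neg.neg).countP (fun x => 0 < x ∧ x ≤ b - 1) = 0 := by
    by_contra! hc
    have := key 2 1 (by omega) (by omega) hc.1
      (by rw [hmap (b - 1) 1 rfl]; exact Nat.pos_of_ne_zero hc.2)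
    push_cast at this
    omega
  have hcard' : b + a - 2 ≤ (S.map Neg.neg).card := by
    rw [Multiset.card_map]
    omega
  obtain ⟨hP, hP1, hP2⟩ := hS.count_dominant h0 hbd ha hb hcard (by rw [← hpa]; exact hp) k30
  obtain ⟨hQ, hQ1, hQ2⟩ := hS.map_neg.count_dominant h0' hbd' hb ha hcard'
    (by rw [← hqa]; exact hq) k03
  simp only [← count_neg_map_neg]
  by_contra! hcon
  have c00 := hcon 0 0 (by norm_num)
  have c01 := hcon 0 1 (by norm_num)
  have c02 := hcon 0 2 (by norm_num)
  have c10 := hcon 1 0 (by norm_num)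
  have c11 := hcon 1 1 (by norm_num)
  have c20 := hcon 2 0 (by norm_num)
  simp only [Nat.cast_zero, Nat.cast_one, Nat.cast_ofNat, sub_zero]
    at c00 c01 c02 c10 c11 c20
  rcases k12 with k12 | k12
  · have hA := hP2 k12
    rcases hQ with hB | hB | hB
    · exact (c00 hA).not_ge hB
    · exact (c01 hA).not_ge hB
    · exact (c02 hA).not_ge hB
  · rcases k21 with k21 | k21
    · rcases hP1 k21 with hA | hA <;> rcases hQ1 k12 with hB | hB
      · exact (c00 hA).not_ge hB
      · exact (c01 hA).not_ge hB
      · exact (c10 hA).not_ge hB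
      · exact (c11 hA).not_ge hB
    · have hB := hQ2 k21
      rcases hP with hA | hA | hA
      · exact (c00 hA).not_ge hB
      · exact (c10 hA).not_ge hB
      · exact (c20 hA).not_ge hB

theorem gcd_eq_one_or_gcd_sub_one_eq_one {p : ℕ} (hp : p.Prime) (k : ℕ) (m : ℤ) :
    Int.gcd ((p ^ k : ℕ) : ℤ) m = 1 ∨ Int.gcd ((p ^ k : ℕ) : ℤ) (m - 1) = 1 := by
  have key (z : ℤ) (hz : Int.gcd ((p ^ k : ℕ) : ℤ) z ≠ 1) : (p : ℤ) ∣ z := by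
    by_contra h
    apply hz
    rw [← Int.isCoprime_iff_gcd_eq_one, Nat.cast_pow]
    exact ((Nat.prime_iff_prime_int.1 hp).coprime_iff_not_dvd.2 h).pow_left
  by_contra! h
  have h1 := dvd_sub (key _ h.1) (key _ h.2)
  rw [sub_sub_cancel] at h1
  exact hp.one_lt.ne' (by exact_mod_cast Int.eq_one_of_dvd_one (by positivity) h1)

theorem fifteen_le_of_gcd_ne_one {m M : ℕ} (hM : 0 < M)
    (h00 : Int.gcd (M : ℤ) m ≠ 1) (h01 : Int.gcd (M : ℤ) (m - 1) ≠ 1)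
    (h10 : Int.gcd (M - 1 : ℤ) m ≠ 1) (h11 : Int.gcd (M - 1 : ℤ) (m - 1) ≠ 1) : 15 ≤ M := by
  have key (p k : ℕ) (hp : p.Prime) : M ≠ p ^ k ∧ M ≠ p ^ k + 1 := by
    constructor
    · rintro rfl
      exact (gcd_eq_one_or_gcd_sub_one_eq_one hp k m).elim h00 h01
    · rintro rfl
      rw [Nat.cast_add, Nat.cast_one, add_sub_cancel_right] at h10 h11
      exact (gcd_eq_one_or_gcd_sub_one_eq_one hp k m).elim h10 h11
  have k20 := key 2 0 (by norm_num)
  have k21 := key 2 1 (by norm_num)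
  have k22 := key 2 2 (by norm_num)
  have k23 := key 2 3 (by norm_num)
  have k31 := key 3 1 (by norm_num)
  have k32 := key 3 2 (by norm_num)
  have k51 := key 5 1 (by norm_num)
  have k71 := key 7 1 (by norm_num)
  have k11 := key 11 1 (by norm_num)
  have k13 := key 13 1 (by norm_num)
  norm_num at *
  omega

theorem IsMinZeroSum.card_le_of_gcd_ne_one {S : Multiset ℤ} (hS : IsMinZeroSum S) {m M : ℕ}
    (hbd : ∀ x ∈ S, -(m : ℤ) ≤ x ∧ x ≤ M) (hm : 15 ≤ m) (hM : 15 ≤ M)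
    (hg : ∀ i j : ℕ, i + j ≤ 2 → (M - i).gcd (m - j) ≠ 1) : S.card + 3 ≤ m + M := by
  by_cases h0 : (0 : ℤ) ∈ S
  · rw [hS.eq_singleton_of_zero_mem h0, Multiset.card_singleton]
    omega
  by_contra! hlt
  obtain ⟨i, j, hij, hi, hj⟩ := hS.exists_dominant h0 hbd (by omega) (by omega) (by omega)
  have hg2 : 2 ≤ (M - i).gcd (m - j) := by
    have := hg i j hij
    have := Nat.gcd_pos_of_pos_left (m - j) (by omega : 0 < M - i)
    omega
  have h1 := Nat.div_le_div_left (a := M - i) hg2 (by norm_num)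
  have h2 := Nat.div_le_div_left (a := m - j) hg2 (by norm_num)
  rw [show (M - i : ℤ) = ((M - i : ℕ) : ℤ) by omega] at hi
  rw [show (m - j : ℤ) = ((m - j : ℕ) : ℤ) by omega] at hj
  have := hS.card_eq_of_count (x := M - i) (y := m - j) (by omega) (by omega) (by omega) (by omega)
  omega

theorem stmt_15 (m M : ℕ) (hm : 0 < m) (hM : 0 < M) (h : rho m M = 3) :
    (davenport m M : ℤ) = (m : ℤ) + (M : ℤ) - 3 := by
  have hgz : ∀ i j : ℕ, i + j ≤ 2 → Int.gcd ((M : ℤ) - i) ((m : ℤ) - j) ≠ 1 := by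
    intro i j hij hg
    have hlt : i + j < rho m M := by omega
    refine Nat.notMem_of_lt_sInf hlt ⟨i, Nat.le_add_right i j, ?_⟩
    rwa [Nat.add_sub_cancel_left]
  have h00 := hgz 0 0 (by norm_num)
  have h01 := hgz 0 1 (by norm_num)
  have h10 := hgz 1 0 (by norm_num)
  have h11 := hgz 1 1 (by norm_num)
  simp only [Nat.cast_zero, Nat.cast_one, sub_zero] at h00 h01 h10 h11
  have hM15 : 15 ≤ M := fifteen_le_of_gcd_ne_one hM h00 h01 h10 h11
  have hm15 : 15 ≤ m := by
    rw [Int.gcd_comm] at h00 h01 h10 h11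
    exact fifteen_le_of_gcd_ne_one hm h00 h10 h01 h11
  have hg : ∀ i j : ℕ, i + j ≤ 2 → (M - i).gcd (m - j) ≠ 1 := by
    intro i j hij
    have := hgz i j hij
    rwa [← Nat.cast_sub (by omega), ← Nat.cast_sub (by omega), Int.gcd_natCast_natCast] at this
  obtain ⟨t, ht, hgt⟩ : rho m M ∈ {t : ℕ | ∃ t' : ℕ, t' ≤ t ∧
      Int.gcd ((M : ℤ) - (t' : ℤ)) ((m : ℤ) - ((t - t' : ℕ) : ℤ)) = 1} :=
    Nat.sInf_mem (Nat.nonempty_of_pos_sInf (by rw [← rho, h]; norm_num))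
  rw [h] at ht hgt
  rw [← Nat.cast_sub (by omega), ← Nat.cast_sub (by omega), Int.gcd_natCast_natCast] at hgt
  have hupper : ∀ n ∈ {n : ℕ | ∃ S : Multiset ℤ, IsMinZeroSum S ∧
      (∀ x ∈ S, -(m : ℤ) ≤ x ∧ x ≤ (M : ℤ)) ∧ S.card = n}, n ≤ m + M - 3 := by
    rintro n ⟨S, hS, hbd, rfl⟩
    have := hS.card_le_of_gcd_ne_one hbd hm15 hM15 hg
    omega
  have hmem : m + M - 3 ∈ {n : ℕ | ∃ S : Multiset ℤ, IsMinZeroSum S ∧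
      (∀ x ∈ S, -(m : ℤ) ≤ x ∧ x ≤ (M : ℤ)) ∧ S.card = n} := by
    refine ⟨_, isMinZeroSum_replicate (by omega) (by omega) hgt, fun x hx => ?_, ?_⟩
    · rcases Multiset.mem_add.1 hx with hx | hx
      · rw [Multiset.eq_of_mem_replicate hx]
        omega
      · rw [Multiset.eq_of_mem_replicate hx]
        omega
    · rw [Multiset.card_add, Multiset.card_replicate, Multiset.card_replicate]
      omega
  have : davenport m M = m + M - 3 :=
    le_antisymm (csSup_le ⟨_, hmem⟩ hupper) (le_csSup ⟨_, hupper⟩ hmem)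
  omega
end
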